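/- arXiv:0711.1319 — 2 statements merged into one kernel-verified Lean document; each statement's English description precedes it below -/
import Mathlib

section
/- Let X be a right A-Galois object and let σ be the modular automorphism of φ. Then there exists an algebra automorphism σ_X of X such that φ_X(y·σ_X(x)) = φ_X(x·y) for all x, y ∈ X; moreover φ_X ∘ σ_X = φ_X. -/
open TensorProduct

noncomputable section

variable (k : Type*) [Field k]

/-- Apply a linear functional to the second tensor factor. -/
def applySnd {M N : Type*} [AddCommGroup M] [Module k M]
    [AddCommGroup N] [Module k N] (f : N →ₗ[k] k) : M ⊗[k] N →ₗ[k] M :=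
  (TensorProduct.rid k M).toLinearMap ∘ₗ LinearMap.lTensor M f

/-- Apply a linear functional to the first tensor factor. -/
def applyFst {M N : Type*} [AddCommGroup M] [Module k M]
    [AddCommGroup N] [Module k N] (f : M →ₗ[k] k) : M ⊗[k] N →ₗ[k] N :=
  (TensorProduct.lid k N).toLinearMap ∘ₗ LinearMap.rTensor N f

variable (A X : Type*) [Ring A] [HopfAlgebra k A] [Ring X] [Algebra k X]

/-- The Galois map `V : X ⊗ X → X ⊗ A`, `x ⊗ y ↦ (x ⊗ 1) * α y`. -/
def galoisV (α : X →ₐ[k] X ⊗[k] A) : X ⊗[k] X →ₗ[k] X ⊗[k] A :=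
  LinearMap.mul' k (X ⊗[k] A) ∘ₗ
    TensorProduct.map ((TensorProduct.mk k X A).flip 1) α.toLinearMap

/-- A Hopf algebra with bijective antipode and faithful left integral `φ`,
together with a right Galois coaction `α` on `X` with trivial coinvariants. -/
structure GaloisContext where
  φ : A →ₗ[k] k
  φ_ne : φ ≠ 0
  φ_integral : ∀ a : A, applySnd k φ (Coalgebra.comul a) = φ a • (1 : A)
  φ_faithful_left : ∀ a : A, (∀ b : A, φ (a * b) = 0) → a = 0
  φ_faithful_right : ∀ a : A, (∀ b : A, φ (b * a) = 0) → a = 0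
  antipode_bijective : Function.Bijective (HopfAlgebra.antipode (R := k) (A := A))
  α : X →ₐ[k] X ⊗[k] A
  coassoc : ∀ x : X,
    TensorProduct.assoc k X A A ((LinearMap.rTensor A α.toLinearMap) (α x))
      = LinearMap.lTensor X (Coalgebra.comul (R := k) (A := A)) (α x)
  counit_id : ∀ x : X,
    applySnd k (Coalgebra.counit (R := k) (A := A)) (α x) = x
  coinv_trivial : ∀ x : X, α x = x ⊗ₜ[k] (1 : A) → ∃ c : k, x = c • (1 : X)
  galois : Function.Bijective (galoisV k A X α)

variable {k A X}

/-- The Galois map as a linear equivalence. -/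
def GaloisContext.V (G : GaloisContext k A X) : (X ⊗[k] X) ≃ₗ[k] (X ⊗[k] A) :=
  LinearEquiv.ofBijective (galoisV k A X G.α) G.galois

/-- The map `β : A → X ⊗ X`, `a ↦ V⁻¹(1 ⊗ a)`. -/
def GaloisContext.β (G : GaloisContext k A X) : A →ₗ[k] X ⊗[k] X :=
  G.V.symm.toLinearMap ∘ₗ TensorProduct.mk k X A 1

end

namespace GaloisAux

open TensorProduct

variable {k : Type*} [Field k] {A X : Type*} [Ring A] [HopfAlgebra k A] [Ring X] [Algebra k X]

lemma applySnd_tmul {M N : Type*} [AddCommGroup M] [Module k M]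
    [AddCommGroup N] [Module k N] (f : N →ₗ[k] k) (m : M) (n : N) :
    applySnd k f (m ⊗ₜ[k] n) = f n • m := by
  simp [applySnd]

lemma applyFst_tmul {M N : Type*} [AddCommGroup M] [Module k M]
    [AddCommGroup N] [Module k N] (f : M →ₗ[k] k) (m : M) (n : N) :
    applyFst k f (m ⊗ₜ[k] n) = f m • n := by
  simp [applyFst]

lemma applySnd_left (f : A →ₗ[k] k) (p : X) (t : X ⊗[k] A) :
    applySnd k f ((p ⊗ₜ[k] (1 : A)) * t) = p * applySnd k f t := by
  induction t with
  | zero => simp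
  | add a b ha hb => simp [mul_add, ha, hb]
  | tmul x a => simp [applySnd_tmul]

lemma applySnd_right (f : A →ₗ[k] k) (p : X) (t : X ⊗[k] A) :
    applySnd k f (t * (p ⊗ₜ[k] (1 : A))) = applySnd k f t * p := by
  induction t with
  | zero => simp
  | add a b ha hb => simp [add_mul, ha, hb]
  | tmul x a => simp [applySnd_tmul]

/-- A functional on the first leg of `t`, then one on the second. -/
lemma dual_swap (f : A →ₗ[k] k) (w : X →ₗ[k] k) (t : X ⊗[k] A) :
    w (applySnd k f t) = f (applyFst k w t) := by
  induction t with
  | zero => simp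
  | add a b ha hb => simp [ha, hb]
  | tmul x a => simp [applySnd_tmul, applyFst_tmul, mul_comm]

lemma applyFst_mul_right (w : X →ₗ[k] k) (t : X ⊗[k] A) (a : A) :
    applyFst k w (t * ((1 : X) ⊗ₜ[k] a)) = applyFst k w t * a := by
  induction t with
  | zero => simp
  | add a b ha hb => simp [add_mul, ha, hb]
  | tmul x a => simp [applyFst_tmul]

lemma applyFst_mul_left (w : X →ₗ[k] k) (t : X ⊗[k] A) (a : A) :
    applyFst k w (((1 : X) ⊗ₜ[k] a) * t) = a * applyFst k w t := by
  induction t with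
  | zero => simp
  | add a b ha hb => simp [mul_add, ha, hb]
  | tmul x a => simp [applyFst_tmul]

lemma galoisV_tmul (α : X →ₐ[k] X ⊗[k] A) (x y : X) :
    galoisV k A X α (x ⊗ₜ[k] y) = (x ⊗ₜ[k] (1 : A)) * α y := by
  simp [galoisV]

/-- The other Galois map `x ⊗ y ↦ α x * (y ⊗ 1)`. -/
def galoisW (α : X →ₐ[k] X ⊗[k] A) : X ⊗[k] X →ₗ[k] X ⊗[k] A :=
  LinearMap.mul' k (X ⊗[k] A) ∘ₗ
    TensorProduct.map α.toLinearMap ((TensorProduct.mk k X A).flip 1)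

lemma galoisW_tmul (α : X →ₐ[k] X ⊗[k] A) (x y : X) :
    galoisW α (x ⊗ₜ[k] y) = α x * (y ⊗ₜ[k] (1 : A)) := by
  simp [galoisW]

lemma galoisV_left (α : X →ₐ[k] X ⊗[k] A) (p : X) (t : X ⊗[k] X) :
    galoisV k A X α ((p ⊗ₜ[k] (1 : X)) * t) = (p ⊗ₜ[k] (1 : A)) * galoisV k A X α t := by
  induction t with
  | zero => simp
  | add a b ha hb => simp [mul_add, ha, hb]
  | tmul x a => simp [galoisV_tmul, ← mul_assoc]

lemma galoisW_right (α : X →ₐ[k] X ⊗[k] A) (p : X) (t : X ⊗[k] X) :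
    galoisW α (t * ((1 : X) ⊗ₜ[k] p)) = galoisW α t * (p ⊗ₜ[k] (1 : A)) := by
  induction t with
  | zero => simp
  | add a b ha hb => simp [add_mul, ha, hb]
  | tmul x a => simp [galoisW_tmul, mul_assoc]

/-- `x ⊗ a ↦ α x * (1 ⊗ S a)`. -/
def theta (α : X →ₐ[k] X ⊗[k] A) : X ⊗[k] A →ₗ[k] X ⊗[k] A :=
  LinearMap.mul' k (X ⊗[k] A) ∘ₗ
    TensorProduct.map α.toLinearMap
      (TensorProduct.mk k X A 1 ∘ₗ HopfAlgebra.antipode k (A := A))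

lemma theta_tmul (α : X →ₐ[k] X ⊗[k] A) (x : X) (a : A) :
    theta α (x ⊗ₜ[k] a) = α x * ((1 : X) ⊗ₜ[k] HopfAlgebra.antipode k a) := by
  simp [theta]

/-- `x ⊗ a ↦ (id ⊗ S)(α x) * (1 ⊗ a)`. -/
def theta' (α : X →ₐ[k] X ⊗[k] A) : X ⊗[k] A →ₗ[k] X ⊗[k] A :=
  LinearMap.mul' k (X ⊗[k] A) ∘ₗ
    TensorProduct.map (LinearMap.lTensor X (HopfAlgebra.antipode k (A := A)) ∘ₗ α.toLinearMap)
      (TensorProduct.mk k X A 1)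

lemma theta'_tmul (α : X →ₐ[k] X ⊗[k] A) (x : X) (a : A) :
    theta' α (x ⊗ₜ[k] a) =
      LinearMap.lTensor X (HopfAlgebra.antipode k (A := A)) (α x) * ((1 : X) ⊗ₜ[k] a) := by
  simp [theta']

lemma theta_left (α : X →ₐ[k] X ⊗[k] A) (p : X) (t : X ⊗[k] A) :
    theta α ((p ⊗ₜ[k] (1 : A)) * t) = α p * theta α t := by
  induction t with
  | zero => simp
  | add a b ha hb => simp [mul_add, ha, hb]
  | tmul x a => simp [theta_tmul, mul_assoc]

lemma theta'_right (α : X →ₐ[k] X ⊗[k] A) (b : A) (t : X ⊗[k] A) :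
    theta' α (t * ((1 : X) ⊗ₜ[k] b)) = theta' α t * ((1 : X) ⊗ₜ[k] b) := by
  induction t with
  | zero => simp
  | add a b ha hb => simp [add_mul, ha, hb]
  | tmul x a => simp [theta'_tmul, mul_assoc]

lemma theta_eq (α : X →ₐ[k] X ⊗[k] A) (t : X ⊗[k] A) :
    theta α t = LinearMap.lTensor X (LinearMap.mul' k A ∘ₗ
      LinearMap.lTensor A (HopfAlgebra.antipode k (A := A)))
        (TensorProduct.assoc k X A A (LinearMap.rTensor A α.toLinearMap t)) := by
  induction t with
  | zero => simp
  | add a b ha hb => simp only [map_add, ha, hb]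
  | tmul x a =>
    rw [theta_tmul, LinearMap.rTensor_tmul, AlgHom.toLinearMap_apply]
    generalize α x = s
    induction s with
    | zero => simp
    | add a b ha hb => simp only [map_add, ha, hb, add_mul, TensorProduct.add_tmul]
    | tmul y b => simp

lemma theta'_eq (α : X →ₐ[k] X ⊗[k] A) (t : X ⊗[k] A) :
    theta' α t = LinearMap.lTensor X (LinearMap.mul' k A ∘ₗ
      LinearMap.rTensor A (HopfAlgebra.antipode k (A := A)))
        (TensorProduct.assoc k X A A (LinearMap.rTensor A α.toLinearMap t)) := by
  induction t with
  | zero => simp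
  | add a b ha hb => simp only [map_add, ha, hb]
  | tmul x a =>
    rw [theta'_tmul, LinearMap.rTensor_tmul, AlgHom.toLinearMap_apply]
    generalize α x = s
    induction s with
    | zero => simp
    | add a b ha hb => simp only [map_add, ha, hb, add_mul, TensorProduct.add_tmul]
    | tmul y b => simp

lemma counit_aux (t : X ⊗[k] A) :
    LinearMap.lTensor X (Algebra.linearMap k A ∘ₗ Coalgebra.counit) t =
      applySnd k (Coalgebra.counit (R := k) (A := A)) t ⊗ₜ[k] (1 : A) := by
  induction t with
  | zero => simp
  | add a b ha hb => simp only [map_add, ha, hb, TensorProduct.add_tmul]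
  | tmul y b => simp [applySnd_tmul, Algebra.algebraMap_eq_smul_one, TensorProduct.smul_tmul']

variable (G : GaloisContext k A X)

lemma theta_alpha (x : X) : theta G.α (G.α x) = x ⊗ₜ[k] (1 : A) := by
  rw [theta_eq, G.coassoc, ← LinearMap.comp_apply, ← LinearMap.lTensor_comp,
    LinearMap.comp_assoc, HopfAlgebra.mul_antipode_lTensor_comul, counit_aux, G.counit_id]

lemma theta'_alpha (x : X) : theta' G.α (G.α x) = x ⊗ₜ[k] (1 : A) := by
  rw [theta'_eq, G.coassoc, ← LinearMap.comp_apply, ← LinearMap.lTensor_comp,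
    LinearMap.comp_assoc, HopfAlgebra.mul_antipode_rTensor_comul, counit_aux, G.counit_id]

lemma theta_V (t : X ⊗[k] X) : theta G.α (galoisV k A X G.α t) = galoisW G.α t := by
  induction t with
  | zero => simp
  | add a b ha hb => simp only [map_add, ha, hb]
  | tmul x y => rw [galoisV_tmul, theta_left, theta_alpha, galoisW_tmul]

lemma theta'_theta (t : X ⊗[k] A) :
    theta' G.α (theta G.α t) = LinearMap.lTensor X (HopfAlgebra.antipode k (A := A)) t := by
  induction t with
  | zero => simp
  | add a b ha hb => simp only [map_add, ha, hb]
  | tmul x y => rw [theta_tmul, theta'_right, theta'_alpha]; simp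

lemma W_injective : Function.Injective (galoisW G.α) := by
  intro s t h
  rw [← theta_V, ← theta_V] at h
  have h2 := congrArg (theta' G.α) h
  rw [theta'_theta, theta'_theta] at h2
  exact G.galois.1
    (Module.Flat.lTensor_preserves_injective_linearMap _ G.antipode_bijective.1 h2)

lemma W_surj_one (a : A) : ∃ t, galoisW G.α t = (1 : X) ⊗ₜ[k] a := by
  obtain ⟨c, hc⟩ := G.antipode_bijective.2 a
  obtain ⟨t, ht⟩ := G.galois.2 ((1 : X) ⊗ₜ[k] c)
  refine ⟨t, ?_⟩
  rw [← theta_V, ht, theta_tmul, hc, map_one, one_mul]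

variable (φX : X →ₗ[k] k)

lemma K1
    (hφX : ∀ x : X, applySnd k G.φ (G.α x) = φX x • (1 : X))
    (x : X) (t : X ⊗[k] X) :
    applySnd k G.φ (galoisV k A X G.α t * G.α x) =
      applySnd k (φX ∘ₗ LinearMap.mulRight k x) t := by
  induction t with
  | zero => simp
  | add a b ha hb => simp only [map_add, add_mul, ha, hb]
  | tmul p q =>
    rw [galoisV_tmul, mul_assoc, ← map_mul, applySnd_left, hφX, applySnd_tmul]
    simp

lemma K2
    (hφX : ∀ x : X, applySnd k G.φ (G.α x) = φX x • (1 : X))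
    (x : X) (t : X ⊗[k] X) :
    applySnd k G.φ (G.α x * galoisW G.α t) =
      applyFst k (φX ∘ₗ LinearMap.mulLeft k x) t := by
  induction t with
  | zero => simp
  | add a b ha hb => simp only [map_add, mul_add, ha, hb]
  | tmul p q =>
    rw [galoisW_tmul, ← mul_assoc, ← map_mul, applySnd_right, hφX, applyFst_tmul]
    simp

lemma alpha_zero (z : X) (h : ∀ w : X →ₗ[k] k, applyFst k w (G.α z) = 0) : z = 0 := by
  rw [← Module.forall_dual_apply_eq_zero_iff k z]
  intro w
  have := dual_swap (Coalgebra.counit (R := k) (A := A)) w (G.α z)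
  rw [G.counit_id] at this
  rw [this, h, map_zero]

lemma faithful_left
    (hφX : ∀ x : X, applySnd k G.φ (G.α x) = φX x • (1 : X))
    (z : X) (h : ∀ x, φX (z * x) = 0) : z = 0 := by
  refine alpha_zero G z fun w => G.φ_faithful_left _ fun a => ?_
  obtain ⟨t, ht⟩ := W_surj_one G a
  have hz : φX ∘ₗ LinearMap.mulLeft k z = 0 := by ext x; simpa using h x
  have := K2 G φX hφX z t
  rw [hz, ht] at this
  rw [← applyFst_mul_right, ← dual_swap, this]
  simp [applyFst]

lemma faithful_right
    (hφX : ∀ x : X, applySnd k G.φ (G.α x) = φX x • (1 : X))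
    (z : X) (h : ∀ x, φX (x * z) = 0) : z = 0 := by
  refine alpha_zero G z fun w => G.φ_faithful_right _ fun a => ?_
  obtain ⟨t, ht⟩ := G.galois.2 ((1 : X) ⊗ₜ[k] a)
  have hz : φX ∘ₗ LinearMap.mulRight k z = 0 := by ext x; simpa using h x
  have := K1 G φX hφX z t
  rw [hz, ht] at this
  rw [← applyFst_mul_left, ← dual_swap, this]
  simp [applySnd]

lemma K3
    (σ : A ≃ₐ[k] A) (hσ : ∀ a b : A, G.φ (a * b) = G.φ (b * σ a))
    (b : A) (t : X ⊗[k] A) :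
    applySnd k G.φ (((1 : X) ⊗ₜ[k] b) * t) = applySnd k G.φ (t * ((1 : X) ⊗ₜ[k] σ b)) := by
  induction t with
  | zero => simp
  | add a b ha hb => simp only [map_add, mul_add, add_mul, ha, hb]
  | tmul p q => simp [applySnd_tmul, hσ b q]

lemma out1 (x : X) (w : X →ₗ[k] k) (t : X ⊗[k] X) :
    w (applySnd k (φX ∘ₗ LinearMap.mulRight k x) t) = φX (applyFst k w t * x) := by
  induction t with
  | zero => simp
  | add a b ha hb => simp only [map_add, add_mul, ha, hb]
  | tmul p q => simp [applySnd_tmul, applyFst_tmul, mul_comm]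

lemma out2 (x : X) (w : X →ₗ[k] k) (t : X ⊗[k] X) :
    w (applyFst k (φX ∘ₗ LinearMap.mulLeft k x) t) = φX (x * applySnd k w t) := by
  induction t with
  | zero => simp
  | add a b ha hb => simp only [map_add, mul_add, ha, hb]
  | tmul p q => simp [applySnd_tmul, applyFst_tmul, mul_comm]

lemma key
    (hφX : ∀ x : X, applySnd k G.φ (G.α x) = φX x • (1 : X))
    (σ : A ≃ₐ[k] A) (hσ : ∀ a b : A, G.φ (a * b) = G.φ (b * σ a))
    (w : X →ₗ[k] k) (b : A) (t t' : X ⊗[k] X)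
    (ht : galoisV k A X G.α t = (1 : X) ⊗ₜ[k] b)
    (ht' : galoisW G.α t' = (1 : X) ⊗ₜ[k] σ b) (x : X) :
    φX (applyFst k w t * x) = φX (x * applySnd k w t') := by
  rw [← out1, ← out2, ← K1 G φX hφX, ← K2 G φX hφX, ht, ht', K3 G σ hσ]

lemma applyFst_left (w : X →ₗ[k] k) (p : X) (t : X ⊗[k] X) :
    applyFst k w ((p ⊗ₜ[k] (1 : X)) * t) = applyFst k (w ∘ₗ LinearMap.mulLeft k p) t := by
  induction t with
  | zero => simp
  | add a b ha hb => simp only [map_add, mul_add, ha, hb]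
  | tmul x y => simp [applyFst_tmul]

lemma applySnd_right' (w : X →ₗ[k] k) (p : X) (t : X ⊗[k] X) :
    applySnd k w (t * ((1 : X) ⊗ₜ[k] p)) = applySnd k (w ∘ₗ LinearMap.mulRight k p) t := by
  induction t with
  | zero => simp
  | add a b ha hb => simp only [map_add, add_mul, ha, hb]
  | tmul x y => simp [applySnd_tmul]

lemma ex1
    (hφX : ∀ x : X, applySnd k G.φ (G.α x) = φX x • (1 : X))
    (σ : A ≃ₐ[k] A) (hσ : ∀ a b : A, G.φ (a * b) = G.φ (b * σ a))
    (w : X →ₗ[k] k) (u : X ⊗[k] A) :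
    ∃ t, galoisV k A X G.α t = u ∧ ∃ z', ∀ x, φX (applyFst k w t * x) = φX (x * z') := by
  induction u with
  | zero => exact ⟨0, by simp, 0, by simp⟩
  | add a b ha hb =>
    obtain ⟨s, hs, y, hy⟩ := ha
    obtain ⟨t, ht, z, hz⟩ := hb
    exact ⟨s + t, by simp [hs, ht], y + z, fun x => by simp [add_mul, mul_add, hy, hz]⟩
  | tmul p b =>
    obtain ⟨t, ht⟩ := G.galois.2 ((1 : X) ⊗ₜ[k] b)
    obtain ⟨t', ht'⟩ := W_surj_one G (σ b)
    refine ⟨(p ⊗ₜ[k] (1 : X)) * t, by rw [galoisV_left, ht]; simp,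
      applySnd k (w ∘ₗ LinearMap.mulLeft k p) t', fun x => ?_⟩
    · rw [applyFst_left]
      exact key G φX hφX σ hσ _ b t t' ht ht' x

lemma ex2
    (hφX : ∀ x : X, applySnd k G.φ (G.α x) = φX x • (1 : X))
    (σ : A ≃ₐ[k] A) (hσ : ∀ a b : A, G.φ (a * b) = G.φ (b * σ a))
    (w : X →ₗ[k] k) (u : X ⊗[k] A) :
    ∃ t, galoisW G.α t = u ∧ ∃ z, ∀ x, φX (z * x) = φX (x * applySnd k w t) := by
  induction u with
  | zero => exact ⟨0, by simp, 0, by simp⟩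
  | add a b ha hb =>
    obtain ⟨s, hs, y, hy⟩ := ha
    obtain ⟨t, ht, z, hz⟩ := hb
    exact ⟨s + t, by simp [hs, ht], y + z, fun x => by simp [add_mul, mul_add, hy, hz]⟩
  | tmul p a =>
    obtain ⟨t, ht⟩ := G.galois.2 ((1 : X) ⊗ₜ[k] σ.symm a)
    obtain ⟨t', ht'⟩ := W_surj_one G a
    refine ⟨t' * ((1 : X) ⊗ₜ[k] p), by rw [galoisW_right, ht']; simp,
      applyFst k (w ∘ₗ LinearMap.mulRight k p) t, fun x => ?_⟩
    · rw [applySnd_right']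
      exact key G φX hφX σ hσ _ (σ.symm a) t t' ht (by simpa using ht') x

lemma exists_dual_one [Nontrivial X] : ∃ w : X →ₗ[k] k, w 1 = 1 := by
  obtain ⟨f, hf⟩ := Module.Projective.exists_dual_ne_zero k (one_ne_zero : (1 : X) ≠ 0)
  exact ⟨(f 1)⁻¹ • f, by simp [hf]⟩

lemma ex1'
    (hφX : ∀ x : X, applySnd k G.φ (G.α x) = φX x • (1 : X))
    (σ : A ≃ₐ[k] A) (hσ : ∀ a b : A, G.φ (a * b) = G.φ (b * σ a))
    [Nontrivial X] (z : X) : ∃ z', ∀ x, φX (x * z') = φX (z * x) := by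
  obtain ⟨w, hw⟩ := exists_dual_one (k := k) (X := X)
  obtain ⟨t, ht, z', hz⟩ := ex1 G φX hφX σ hσ w (G.α z)
  have : t = 1 ⊗ₜ[k] z := G.galois.1 (by
    rw [ht, galoisV_tmul, ← Algebra.TensorProduct.one_def, one_mul])
  subst this
  refine ⟨z', fun x => ?_⟩
  rw [← hz, applyFst_tmul, hw, one_smul]

lemma ex2'
    (hφX : ∀ x : X, applySnd k G.φ (G.α x) = φX x • (1 : X))
    (σ : A ≃ₐ[k] A) (hσ : ∀ a b : A, G.φ (a * b) = G.φ (b * σ a))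
    [Nontrivial X] (z' : X) : ∃ z, ∀ x, φX (x * z') = φX (z * x) := by
  obtain ⟨w, hw⟩ := exists_dual_one (k := k) (X := X)
  obtain ⟨t, ht, z, hz⟩ := ex2 G φX hφX σ hσ w (G.α z')
  have : t = z' ⊗ₜ[k] 1 := W_injective G (by
    rw [ht, galoisW_tmul, ← Algebra.TensorProduct.one_def, mul_one])
  subst this
  refine ⟨z, fun x => ?_⟩
  rw [hz, applySnd_tmul, hw, one_smul]

end GaloisAux

theorem galois_object_phiX_modular_automorphism
    {k : Type*} [Field k] {A X : Type*} [Ring A] [HopfAlgebra k A]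
    [Ring X] [Algebra k X] [Nontrivial X]
    (G : GaloisContext k A X)
    (φX : X →ₗ[k] k)
    (hφX : ∀ x : X, applySnd k G.φ (G.α x) = φX x • (1 : X))
    (σ : A ≃ₐ[k] A) (hσ : ∀ a b : A, G.φ (a * b) = G.φ (b * σ a)) :
    ∃ σX : X ≃ₐ[k] X,
      (∀ x y : X, φX (y * σX x) = φX (x * y)) ∧
      (∀ x : X, φX (σX x) = φX x) := by
  choose f hf using GaloisAux.ex1' G φX hφX σ hσ
  have uniq : ∀ a b : X, (∀ x, φX (x * a) = φX (x * b)) → a = b := fun a b h =>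
    sub_eq_zero.1 (GaloisAux.faithful_right G φX hφX _ fun x => by
      rw [mul_sub, map_sub, h, sub_self])
  have uniq' : ∀ a b : X, (∀ x, φX (a * x) = φX (b * x)) → a = b := fun a b h =>
    sub_eq_zero.1 (GaloisAux.faithful_left G φX hφX _ fun x => by
      rw [sub_mul, map_sub, h, sub_self])
  let F : X →ₐ[k] X :=
    { toFun := f
      map_one' := uniq _ _ fun x => by rw [hf, one_mul, mul_one]
      map_mul' := fun a b => uniq _ _ fun x => by
        rw [hf, ← mul_assoc, hf, ← mul_assoc, hf, mul_assoc]
      map_zero' := uniq _ _ fun x => by rw [hf]; simp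
      map_add' := fun a b => uniq _ _ fun x => by
        rw [hf, mul_add, map_add, hf, hf, add_mul, map_add]
      commutes' := fun r => uniq _ _ fun x => by rw [hf, Algebra.commutes] }
  have hF : ∀ z x, φX (x * F z) = φX (z * x) := hf
  have hb : Function.Bijective F := by
    refine ⟨fun a b h => uniq' _ _ fun x => by rw [← hF a, ← hF b, h], fun z' => ?_⟩
    obtain ⟨z, hz⟩ := GaloisAux.ex2' G φX hφX σ hσ z'
    exact ⟨z, uniq _ _ fun x => by rw [hF, hz]⟩
  refine ⟨AlgEquiv.ofBijective F hb, fun x y => hF x y, fun x => ?_⟩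
  have := hF x 1
  rw [one_mul, mul_one] at this
  exact this
end

section
/- Let X be a right A-Galois object and θ_X(x) = ε(σ⁻¹(x₍₁₎))·σ_X(x₍₀₎). Then: (i) σ_X ∘ θ_X = θ_X ∘ σ_X; (ii) θ_X(δ_X) = δ_X; (iii) φ_X ∘ θ_X = τ·φ_X, where τ is the scaling constant of A. -/
open TensorProduct

/-- The analogue `θ_X` of the square of the antipode on a Galois object:
`θ_X(x) = ε(σ⁻¹(x₍₁₎)) • σ_X(x₍₀₎)`. -/
noncomputable def thetaX {k : Type*} [Field k] {A X : Type*} [Ring A] [HopfAlgebra k A]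
    [Ring X] [Algebra k X] (G : GaloisContext k A X) (σ : A ≃ₐ[k] A) (σX : X ≃ₐ[k] X) :
    X →ₗ[k] X :=
  σX.toLinearMap ∘ₗ
    applySnd k ((Coalgebra.counit (R := k) (A := A)) ∘ₗ σ.symm.toLinearMap) ∘ₗ
      G.α.toLinearMap

section GaloisHelpers

open TensorProduct Coalgebra HopfAlgebra

variable {k : Type*} [Field k]

section Lin
variable {M N : Type*} [AddCommGroup M] [Module k M] [AddCommGroup N] [Module k N]

theorem applySnd_tmul (f : N →ₗ[k] k) (m : M) (n : N) :
    applySnd k f (m ⊗ₜ[k] n) = f n • m := by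
  simp [applySnd]

theorem applyFst_tmul (f : M →ₗ[k] k) (m : M) (n : N) :
    applyFst k f (m ⊗ₜ[k] n) = f m • n := by
  simp [applyFst]

theorem slice_swap (f : N →ₗ[k] k) (g : M →ₗ[k] k) (T : M ⊗[k] N) :
    g (applySnd k f T) = f (applyFst k g T) := by
  induction T with
  | zero => simp
  | add x y hx hy => simp [hx, hy]
  | tmul m n => simp [applySnd_tmul, applyFst_tmul, mul_comm]

theorem slice_left_zero (Z : M ⊗[k] N) (h : ∀ g : M →ₗ[k] k, applyFst k g Z = 0) : Z = 0 := by
  classical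
  let b := Module.Basis.ofVectorSpace k M
  apply (TensorProduct.equivFinsuppOfBasisLeft (N := N) b).injective
  rw [map_zero]
  ext i
  have key : ∀ T : M ⊗[k] N, (TensorProduct.equivFinsuppOfBasisLeft (N := N) b) T i
      = applyFst k (b.coord i) T := by
    intro T
    induction T with
    | zero => simp
    | add x y hx hy => simp only [map_add, Finsupp.add_apply, hx, hy]
    | tmul m n =>
      simp [applyFst_tmul, TensorProduct.equivFinsuppOfBasisLeft_apply_tmul_apply]
  rw [key, h]; rfl

theorem slice_right_zero (Z : M ⊗[k] N) (h : ∀ g : N →ₗ[k] k, applySnd k g Z = 0) : Z = 0 := by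
  apply slice_left_zero
  intro g
  rw [← Module.forall_dual_apply_eq_zero_iff k]
  intro f
  rw [← slice_swap, h, map_zero]

/-- separation by a family of functionals in the second leg -/
theorem sep_snd {ι : Type*} (F : ι → N →ₗ[k] k) (hF : ∀ n, (∀ i, F i n = 0) → n = 0)
    (Z : M ⊗[k] N) (h : ∀ i, applySnd k (F i) Z = 0) : Z = 0 := by
  apply slice_left_zero
  intro g
  apply hF
  intro i
  rw [← slice_swap, h, map_zero]

theorem sep_fst {ι : Type*} (F : ι → M →ₗ[k] k) (hF : ∀ n, (∀ i, F i n = 0) → n = 0)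
    (Z : M ⊗[k] N) (h : ∀ i, applyFst k (F i) Z = 0) : Z = 0 := by
  apply slice_right_zero
  intro g
  apply hF
  intro i
  rw [slice_swap, h, map_zero]

end Lin

section Alg
variable {B A : Type*} [Ring B] [Algebra k B] [Ring A] [Algebra k A]

theorem applySnd_tmul_mul (f : A →ₗ[k] k) (w : B) (v : A) (D : B ⊗[k] A) :
    applySnd k f ((w ⊗ₜ[k] v) * D) = w * applySnd k (f ∘ₗ LinearMap.mulLeft k v) D := by
  induction D with
  | zero => simp
  | add x y hx hy => simp [mul_add, hx, hy]
  | tmul m n => simp [applySnd_tmul]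

theorem applySnd_mul_tmul (f : A →ₗ[k] k) (w : B) (v : A) (D : B ⊗[k] A) :
    applySnd k f (D * (w ⊗ₜ[k] v)) = applySnd k (f ∘ₗ LinearMap.mulRight k v) D * w := by
  induction D with
  | zero => simp
  | add x y hx hy => simp [add_mul, hx, hy]
  | tmul m n => simp [applySnd_tmul]

theorem applyFst_tmul_mul (f : B →ₗ[k] k) (w : B) (v : A) (D : B ⊗[k] A) :
    applyFst k f ((w ⊗ₜ[k] v) * D) = v * applyFst k (f ∘ₗ LinearMap.mulLeft k w) D := by
  induction D with
  | zero => simp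
  | add x y hx hy => simp [mul_add, hx, hy]
  | tmul m n => simp [applyFst_tmul]

theorem applyFst_mul_tmul (f : B →ₗ[k] k) (w : B) (v : A) (D : B ⊗[k] A) :
    applyFst k f (D * (w ⊗ₜ[k] v)) = applyFst k (f ∘ₗ LinearMap.mulRight k w) D * v := by
  induction D with
  | zero => simp
  | add x y hx hy => simp [add_mul, hx, hy]
  | tmul m n => simp [applyFst_tmul]

theorem applySnd_mul_of_mul (f : A →ₗ[k] k) (hf : ∀ a b, f (a * b) = f a * f b)
    (s t : B ⊗[k] A) : applySnd k f (s * t) = applySnd k f s * applySnd k f t := by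
  induction s with
  | zero => simp
  | add x y hx hy => simp [add_mul, hx, hy]
  | tmul w v =>
    induction t with
    | zero => simp
    | add x y hx hy => simp [mul_add, hx, hy]
    | tmul m n => simp [applySnd_tmul, hf, smul_smul, mul_comm]

end Alg

section Hopf
variable {A : Type*} [Ring A] [HopfAlgebra k A]

theorem applyFst_counit (a : A) : applyFst k (counit (R := k) (A := A)) (comul a) = a := by
  simp [applyFst]

/-- `S(a₁) φ(a₂ b) = b₁ φ(a b₂)` -/
theorem strong_inv (φ : A →ₗ[k] k)
    (hφ : ∀ a : A, applySnd k φ (comul a) = φ a • (1 : A)) (a b : A) :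
    antipode k (applySnd k (φ ∘ₗ LinearMap.mulRight k b) (comul a)) =
      applySnd k (φ ∘ₗ LinearMap.mulLeft k a) (comul b) := by
  let L : A ⊗[k] (A ⊗[k] A) →ₗ[k] A :=
    LinearMap.mul' k A ∘ₗ TensorProduct.map (antipode k)
      (applySnd k φ ∘ₗ LinearMap.mulRight k (comul (R := k) b))
  have h1 : ∀ T : A ⊗[k] A, L (LinearMap.lTensor A comul T) =
      antipode k (applySnd k (φ ∘ₗ LinearMap.mulRight k b) T) := by
    intro T
    induction T with
    | zero => simp
    | add x y hx hy => simp only [map_add, hx, hy]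
    | tmul u v =>
      simp [L, applySnd_tmul, ← Bialgebra.comul_mul, hφ]
  have h2 : ∀ (t : A ⊗[k] A) (v : A), L (TensorProduct.assoc k A A A (t ⊗ₜ[k] v)) =
      LinearMap.mul' k A (LinearMap.rTensor A (antipode k) t) *
        applySnd k (φ ∘ₗ LinearMap.mulLeft k v) (comul b) := by
    intro t v
    induction t with
    | zero => simp
    | add x y hx hy => simp only [map_add, add_mul, TensorProduct.add_tmul, hx, hy]
    | tmul u w => simp [L, applySnd_tmul_mul, mul_assoc]
  have h3 : ∀ T : A ⊗[k] A, L (TensorProduct.assoc k A A A (LinearMap.rTensor A comul T)) =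
      applySnd k φ ((1 ⊗ₜ[k] applyFst k (counit (R := k) (A := A)) T) * comul b) := by
    intro T
    induction T with
    | zero => simp
    | add x y hx hy => simp only [map_add, add_mul, TensorProduct.tmul_add, hx, hy]
    | tmul u v =>
      rw [LinearMap.rTensor_tmul, h2, mul_antipode_rTensor_comul_apply, applyFst_tmul,
        ← TensorProduct.smul_tmul, applySnd_tmul_mul, smul_mul_assoc, one_mul,
        ← Algebra.smul_def]
  rw [← h1, ← coassoc_apply, h3, applyFst_counit, applySnd_tmul_mul, one_mul]

theorem antipode_R (a : A) : LinearMap.mul' k (A ⊗[k] A) (TensorProduct.map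
      ((TensorProduct.mk k A A).flip 1 ∘ₗ antipode k) (comul (R := k) (A := A)) (comul a))
      = (1 : A) ⊗ₜ[k] a := by
  let L : A ⊗[k] (A ⊗[k] A) →ₗ[k] A ⊗[k] A :=
    LinearMap.mul' k (A ⊗[k] A) ∘ₗ TensorProduct.map
      ((TensorProduct.mk k A A).flip 1 ∘ₗ antipode k) LinearMap.id
  have h1 : ∀ T : A ⊗[k] A, L (LinearMap.lTensor A comul T) =
      LinearMap.mul' k (A ⊗[k] A) (TensorProduct.map
      ((TensorProduct.mk k A A).flip 1 ∘ₗ antipode k) (comul (R := k) (A := A)) T) := by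
    intro T
    induction T with
    | zero => simp
    | add x y hx hy => simp only [map_add, hx, hy]
    | tmul u v => simp [L]
  have h2 : ∀ (t : A ⊗[k] A) (v : A), L (TensorProduct.assoc k A A A (t ⊗ₜ[k] v)) =
      LinearMap.mul' k A (LinearMap.rTensor A (antipode k) t) ⊗ₜ[k] v := by
    intro t v
    induction t with
    | zero => simp
    | add x y hx hy => simp only [map_add, TensorProduct.add_tmul, hx, hy]
    | tmul u w => simp [L]
  have h3 : ∀ T : A ⊗[k] A, L (TensorProduct.assoc k A A A (LinearMap.rTensor A comul T)) =
      (1 : A) ⊗ₜ[k] applyFst k (counit (R := k) (A := A)) T := by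
    intro T
    induction T with
    | zero => simp
    | add x y hx hy => simp only [map_add, TensorProduct.tmul_add, hx, hy]
    | tmul u v =>
      rw [LinearMap.rTensor_tmul, h2, mul_antipode_rTensor_comul_apply, applyFst_tmul,
        ← TensorProduct.smul_tmul, ← Algebra.algebraMap_eq_smul_one]
  rw [← h1, ← coassoc_apply, h3, applyFst_counit]

theorem comul_left_inv' (a : A) : LinearMap.mul' k (A ⊗[k] A) (TensorProduct.map
      (TensorProduct.map (antipode k) (antipode k) ∘ₗ (TensorProduct.comm k A A).toLinearMap
        ∘ₗ comul (R := k) (A := A)) (comul (R := k) (A := A)) (comul a))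
      = algebraMap k (A ⊗[k] A) (counit a) := by
  let L : A ⊗[k] (A ⊗[k] A) →ₗ[k] A ⊗[k] A :=
    LinearMap.mul' k (A ⊗[k] A) ∘ₗ TensorProduct.map
      (TensorProduct.mk k A A 1 ∘ₗ antipode k)
      (LinearMap.mul' k (A ⊗[k] A) ∘ₗ TensorProduct.map
      ((TensorProduct.mk k A A).flip 1 ∘ₗ antipode k) (comul (R := k) (A := A)))
  have h1 : ∀ T : A ⊗[k] A, L (LinearMap.lTensor A comul T) =
      (1 : A) ⊗ₜ[k] LinearMap.mul' k A (LinearMap.rTensor A (antipode k) T) := by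
    intro T
    induction T with
    | zero => simp
    | add x y hx hy => simp only [map_add, TensorProduct.tmul_add, hx, hy]
    | tmul u v => 
      simp only [L, LinearMap.lTensor_tmul, LinearMap.comp_apply, TensorProduct.map_tmul,
        antipode_R]
      simp
  have h2 : ∀ (t : A ⊗[k] A) (v : A), L (TensorProduct.assoc k A A A (t ⊗ₜ[k] v)) =
      TensorProduct.map (antipode k) (antipode k) (TensorProduct.comm k A A t) * comul v := by
    intro t v
    induction t with
    | zero => simp
    | add x y hx hy => simp only [map_add, TensorProduct.add_tmul, add_mul, hx, hy]
    | tmul u w => simp [L, ← mul_assoc]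
  have h3 : ∀ T : A ⊗[k] A, L (TensorProduct.assoc k A A A (LinearMap.rTensor A comul T)) =
      LinearMap.mul' k (A ⊗[k] A) (TensorProduct.map
      (TensorProduct.map (antipode k) (antipode k) ∘ₗ (TensorProduct.comm k A A).toLinearMap
        ∘ₗ comul (R := k) (A := A)) (comul (R := k) (A := A)) T) := by
    intro T
    induction T with
    | zero => simp
    | add x y hx hy => simp only [map_add, hx, hy]
    | tmul u v =>
      rw [LinearMap.rTensor_tmul, h2]
      simp
  rw [← h3, coassoc_apply, h1, mul_antipode_rTensor_comul_apply]
  simp [Algebra.algebraMap_eq_smul_one, Algebra.TensorProduct.one_def]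

theorem comul_antipode' (a : A) : comul (R := k) (antipode k a) =
    TensorProduct.map (antipode k) (antipode k) (TensorProduct.comm k A A (comul a)) := by
  have key : WithConv.toConv (TensorProduct.map (antipode k) (antipode k) ∘ₗ
      (TensorProduct.comm k A A).toLinearMap ∘ₗ comul (R := k) (A := A))
      = WithConv.toConv (comul (R := k) (A := A) ∘ₗ antipode k) := by
    apply left_inv_eq_right_inv (a := WithConv.toConv (comul (R := k) (A := A)))
    · apply WithConv.ext
      simp only [LinearMap.convMul_def, LinearMap.convOne_def]
      ext a
      have := comul_left_inv' (k := k) a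
      simpa using this
    · exact LinearMap.comul_right_inv
  have := congrArg (fun f => f.ofConv a) key
  simpa using this.symm

theorem right_inv_phiS (φ : A →ₗ[k] k)
    (hφ : ∀ a : A, applySnd k φ (comul a) = φ a • (1 : A))
    (hS : Function.Bijective (antipode k (A := A))) (a : A) :
    applyFst k (φ ∘ₗ antipode k) (comul a) = φ (antipode k a) • (1 : A) := by
  apply hS.1
  have h : ∀ T : A ⊗[k] A, antipode k (applyFst k (φ ∘ₗ antipode k) T) =
      applySnd k φ (TensorProduct.map (antipode k) (antipode k) (TensorProduct.comm k A A T)) := by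
    intro T
    induction T with
    | zero => simp
    | add x y hx hy => simp only [map_add, hx, hy]
    | tmul u v => simp [applyFst_tmul, applySnd_tmul]
  rw [h, ← comul_antipode', hφ]
  simp

theorem exists_delta (φ : A →ₗ[k] k) (hne : φ ≠ 0)
    (hφ : ∀ a : A, applySnd k φ (comul a) = φ a • (1 : A))
    (hf : ∀ a : A, (∀ b : A, φ (b * a) = 0) → a = 0)
    (hS : Function.Bijective (antipode k (A := A))) :
    ∃ δ : A, ∀ a : A, applyFst k φ (comul a) = φ a • δ := by
  have key : ∀ a b : A, φ (a * applyFst k φ (comul b)) = φ (antipode k a) * φ b := by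
    intro a b
    have h := congrArg φ (strong_inv φ hφ a b)
    rw [slice_swap] at h
    have h2 := slice_swap (φ ∘ₗ LinearMap.mulRight k b) (φ ∘ₗ antipode k) (comul (R := k) a)
    rw [right_inv_phiS φ hφ hS] at h2
    simp only [LinearMap.comp_apply] at h2
    rw [h2] at h
    simpa using h.symm
  obtain ⟨c, hc⟩ : ∃ c, φ c ≠ 0 := by
    by_contra! hcon
    exact hne (LinearMap.ext hcon)
  refine ⟨(φ c)⁻¹ • applyFst k φ (comul c), fun a => ?_⟩
  rw [← sub_eq_zero]
  apply hf
  intro b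
  rw [mul_sub, map_sub, key, mul_smul_comm, mul_smul_comm, map_smul, map_smul, key]
  simp only [smul_eq_mul]
  field_simp
  ring

theorem comul_sigma (φ : A →ₗ[k] k)
    (hφ : ∀ a : A, applySnd k φ (comul a) = φ a • (1 : A))
    (hf : ∀ a : A, (∀ b : A, φ (b * a) = 0) → a = 0)
    (σ : A ≃ₐ[k] A) (hσ : ∀ a b : A, φ (a * b) = φ (b * σ a)) (a : A) :
    comul (R := k) (σ a) =
      TensorProduct.map (antipode k ∘ₗ antipode k) σ.toLinearMap (comul a) := by
  rw [← sub_eq_zero]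
  apply sep_snd (fun b : A => φ ∘ₗ LinearMap.mulLeft k b) (fun n hn => hf n hn)
  intro b
  have e1 : φ ∘ₗ LinearMap.mulRight k (σ a) = φ ∘ₗ LinearMap.mulLeft k a := by
    ext c; simp [hσ a c]
  have e2 : ∀ T : A ⊗[k] A, antipode k (antipode k
      (applySnd k (φ ∘ₗ LinearMap.mulRight k b) T)) =
      applySnd k (φ ∘ₗ LinearMap.mulLeft k b)
        (TensorProduct.map (antipode k ∘ₗ antipode k) σ.toLinearMap T) := by
    intro T
    induction T with
    | zero => simp
    | add x y hx hy => simp only [map_add, hx, hy]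
    | tmul u v => simp [applySnd_tmul, hσ v b]
  rw [map_sub, sub_eq_zero, ← e2, strong_inv φ hφ, ← e1, strong_inv φ hφ]

end Hopf

section Gal
variable {A X : Type*} [Ring A] [HopfAlgebra k A] [Ring X] [Algebra k X]

theorem phiX_slice [Nontrivial X] (G : GaloisContext k A X) (φX : X →ₗ[k] k)
    (hφX : ∀ x : X, applySnd k G.φ (G.α x) = φX x • (1 : X)) (δ : A)
    (hδ : ∀ a : A, applyFst k G.φ (comul a) = G.φ a • δ) (x : X) :
    applyFst k φX (G.α x) = φX x • δ := by
  let L : X ⊗[k] (A ⊗[k] A) →ₗ[k] X ⊗[k] A := LinearMap.lTensor X (applyFst k G.φ)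
  have h2 : ∀ (t : X ⊗[k] A) (v : A), L (TensorProduct.assoc k X A A (t ⊗ₜ[k] v)) =
      applySnd k G.φ t ⊗ₜ[k] v := by
    intro t v
    induction t with
    | zero => simp
    | add x y hx hy => simp only [map_add, TensorProduct.add_tmul, hx, hy]
    | tmul u w =>
      simp [L, applySnd_tmul, applyFst_tmul, TensorProduct.smul_tmul]
  have h3 : ∀ T : X ⊗[k] A,
      L (TensorProduct.assoc k X A A (LinearMap.rTensor A G.α.toLinearMap T)) =
      (1 : X) ⊗ₜ[k] applyFst k φX T := by
    intro T
    induction T with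
    | zero => simp
    | add x y hx hy => simp only [map_add, TensorProduct.tmul_add, hx, hy]
    | tmul u v =>
      rw [LinearMap.rTensor_tmul, h2, AlgHom.toLinearMap_apply, hφX, applyFst_tmul,
        TensorProduct.smul_tmul]
  have h4 : ∀ T : X ⊗[k] A, L (LinearMap.lTensor X comul T) = applySnd k G.φ T ⊗ₜ[k] δ := by
    intro T
    induction T with
    | zero => simp
    | add x y hx hy => simp only [map_add, TensorProduct.add_tmul, hx, hy]
    | tmul u v => simp [L, hδ, applySnd_tmul, TensorProduct.smul_tmul]
  have h5 : (1 : X) ⊗ₜ[k] applyFst k φX (G.α x) = (1 : X) ⊗ₜ[k] (φX x • δ) := by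
    rw [← h3, G.coassoc, h4, hφX, TensorProduct.smul_tmul]
  obtain ⟨g, hg⟩ : ∃ g : X →ₗ[k] k, g 1 ≠ 0 := by
    by_contra! hcon
    exact one_ne_zero ((Module.forall_dual_apply_eq_zero_iff k (1 : X)).1 hcon)
  have h6 := congrArg (applyFst k g) h5
  rw [applyFst_tmul, applyFst_tmul] at h6
  exact smul_right_injective _ hg h6

theorem phiX_faithful (G : GaloisContext k A X) (φX : X →ₗ[k] k)
    (hφX : ∀ x : X, applySnd k G.φ (G.α x) = φX x • (1 : X)) (z : X)
    (hz : ∀ y, φX (y * z) = 0) : z = 0 := by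
  have h1 : ∀ T : X ⊗[k] X, applySnd k G.φ (galoisV k A X G.α T * G.α z) = 0 := by
    intro T
    induction T with
    | zero => simp
    | add x y hx hy => simp only [map_add, add_mul, hx, hy, add_zero]
    | tmul x y =>
      have : galoisV k A X G.α (x ⊗ₜ[k] y) = (x ⊗ₜ[k] (1 : A)) * G.α y := by
        simp [galoisV]
      rw [this, mul_assoc, ← map_mul, applySnd_tmul_mul, LinearMap.mulLeft_one,
        LinearMap.comp_id, hφX, hz]
      simp
  have h2 : G.α z = 0 := by
    apply sep_snd (fun b : A => G.φ ∘ₗ LinearMap.mulLeft k b)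
      (fun n hn => G.φ_faithful_right n hn)
    intro a
    obtain ⟨T, hT⟩ := G.galois.2 ((1 : X) ⊗ₜ[k] a)
    have := h1 T
    rwa [hT, applySnd_tmul_mul, one_mul] at this
  rw [← G.counit_id z, h2, map_zero]

theorem rho_surj (G : GaloisContext k A X) (f : A →ₐ[k] k) (x : X) :
    applySnd k f.toLinearMap (G.α (applySnd k (f.toLinearMap ∘ₗ antipode k) (G.α x))) = x := by
  let Q : X ⊗[k] (A ⊗[k] A) →ₗ[k] X :=
    applySnd k (LinearMap.mul' k k ∘ₗ
      TensorProduct.map f.toLinearMap (f.toLinearMap ∘ₗ antipode k))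
  have h2 : ∀ (t : X ⊗[k] A) (v : A), Q (TensorProduct.assoc k X A A (t ⊗ₜ[k] v)) =
      f (antipode k v) • applySnd k f.toLinearMap t := by
    intro t v
    induction t with
    | zero => simp
    | add x y hx hy => simp only [map_add, TensorProduct.add_tmul, smul_add, hx, hy]
    | tmul u w => simp [Q, applySnd_tmul, smul_smul, mul_comm]
  have h3 : ∀ T : X ⊗[k] A,
      Q (TensorProduct.assoc k X A A (LinearMap.rTensor A G.α.toLinearMap T)) =
      applySnd k f.toLinearMap (G.α (applySnd k (f.toLinearMap ∘ₗ antipode k) T)) := by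
    intro T
    induction T with
    | zero => simp
    | add x y hx hy => simp only [map_add, hx, hy]
    | tmul u v =>
      rw [LinearMap.rTensor_tmul, h2]
      simp [applySnd_tmul]
  have h0 : ∀ T : A ⊗[k] A, LinearMap.mul' k k
      (TensorProduct.map f.toLinearMap (f.toLinearMap ∘ₗ antipode k) T) =
      f (LinearMap.mul' k A (LinearMap.lTensor A (antipode k) T)) := by
    intro T
    induction T with
    | zero => simp
    | add x y hx hy => simp only [map_add, hx, hy]
    | tmul u v => simp
  have h4 : ∀ T : X ⊗[k] A, Q (LinearMap.lTensor X comul T) =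
      applySnd k (counit (R := k) (A := A)) T := by
    intro T
    induction T with
    | zero => simp
    | add x y hx hy => simp only [map_add, hx, hy]
    | tmul u v =>
      simp only [Q, LinearMap.lTensor_tmul, applySnd_tmul, LinearMap.comp_apply, h0]
      simp
  rw [← h3, G.coassoc, h4, G.counit_id]

theorem antipode_inv_mul (hS : Function.Bijective (antipode k (A := A))) (a : A) :
    TensorProduct.lift ((LinearMap.mul k A).flip.compl₂
      (LinearEquiv.ofBijective (antipode k (A := A)) hS).symm.toLinearMap) (comul (R := k) a)
      = counit (R := k) a • (1 : A) := by
  apply hS.1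
  have h : ∀ T : A ⊗[k] A, antipode k (TensorProduct.lift ((LinearMap.mul k A).flip.compl₂
      (LinearEquiv.ofBijective (antipode k (A := A)) hS).symm.toLinearMap) T) =
      LinearMap.mul' k A (LinearMap.rTensor A (antipode k) T) := by
    intro T
    induction T with
    | zero => simp
    | add x y hx hy => simp only [map_add, hx, hy]
    | tmul u v =>
      have e : antipode k ((LinearEquiv.ofBijective (antipode k (A := A)) hS).symm v) = v :=
        (LinearEquiv.ofBijective (antipode k (A := A)) hS).apply_symm_apply v
      simp [antipode_mul_antidistrib, e]
  rw [h, mul_antipode_rTensor_comul_apply, map_smul, antipode_one,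
    Algebra.algebraMap_eq_smul_one]

theorem alpha_span (G : GaloisContext k A X) (φX : X →ₗ[k] k) (Z : X ⊗[k] A)
    (hZ : ∀ x, applyFst k φX (G.α x * Z) = 0) (x : X) :
    applyFst k φX ((x ⊗ₜ[k] (1 : A)) * Z) = 0 := by
  let m : A ⊗[k] A →ₗ[k] A := TensorProduct.lift ((LinearMap.mul k A).flip.compl₂
      (LinearEquiv.ofBijective (antipode k (A := A)) G.antipode_bijective).symm.toLinearMap)
  let P : X ⊗[k] (A ⊗[k] A) →ₗ[k] A :=
    applyFst k φX ∘ₗ LinearMap.mulRight k Z ∘ₗ LinearMap.lTensor X m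
  have h2 : ∀ (t : X ⊗[k] A) (v : A), P (TensorProduct.assoc k X A A (t ⊗ₜ[k] v)) =
      (LinearEquiv.ofBijective (antipode k (A := A)) G.antipode_bijective).symm v *
        applyFst k φX (t * Z) := by
    intro t v
    induction t with
    | zero => simp
    | add x y hx hy => simp only [map_add, TensorProduct.add_tmul, add_mul, mul_add, hx, hy]
    | tmul u w => simp [P, m, applyFst_tmul_mul, mul_assoc]
  have h3 : ∀ T : X ⊗[k] A,
      P (TensorProduct.assoc k X A A (LinearMap.rTensor A G.α.toLinearMap T)) = 0 := by
    intro T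
    induction T with
    | zero => simp
    | add x y hx hy => simp only [map_add, hx, hy, add_zero]
    | tmul u v =>
      rw [LinearMap.rTensor_tmul, h2, AlgHom.toLinearMap_apply, hZ, mul_zero]
  have h4 : ∀ T : X ⊗[k] A, P (LinearMap.lTensor X comul T) =
      applyFst k φX ((applySnd k (counit (R := k) (A := A)) T ⊗ₜ[k] (1 : A)) * Z) := by
    intro T
    induction T with
    | zero => simp
    | add x y hx hy => simp only [map_add, TensorProduct.add_tmul, add_mul, hx, hy]
    | tmul u v =>
      have e : m (comul v) = counit (R := k) v • (1 : A) :=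
        antipode_inv_mul G.antipode_bijective v
      simp only [P, LinearMap.comp_apply, LinearMap.lTensor_tmul, e, applySnd_tmul,
        LinearMap.mulRight_apply, TensorProduct.smul_tmul]
  have h5 := h4 (G.α x)
  rw [G.counit_id, ← G.coassoc, h3] at h5
  exact h5.symm

end Gal

end GaloisHelpers

theorem galois_object_thetaX_modular_formulas
    {k : Type*} [Field k] {A X : Type*} [Ring A] [HopfAlgebra k A]
    [Ring X] [Algebra k X] [Nontrivial X]
    (G : GaloisContext k A X)
    (φX : X →ₗ[k] k)
    (hφX : ∀ x : X, applySnd k G.φ (G.α x) = φX x • (1 : X))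
    (ψX : X →ₗ[k] k) (hψX_ne : ψX ≠ 0)
    (hψX : ∀ x : X, applyFst k ψX (G.α x) = ψX x • (1 : A))
    (δX : Xˣ) (hδX : ∀ x : X, φX (x * δX) = ψX x)
    (σ : A ≃ₐ[k] A) (hσ : ∀ a b : A, G.φ (a * b) = G.φ (b * σ a))
    (σX : X ≃ₐ[k] X) (hσX : ∀ x y : X, φX (y * σX x) = φX (x * y))
    (τ : k) (hτ_ne : τ ≠ 0)
    (hτ : ∀ a : A, G.φ (HopfAlgebra.antipode (R := k) (A := A)
      (HopfAlgebra.antipode (R := k) (A := A) a)) = τ * G.φ a) :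
    (∀ x : X, σX (thetaX G σ σX x) = thetaX G σ σX (σX x)) ∧
    thetaX G σ σX ↑δX = (↑δX : X) ∧
    (∀ x : X, φX (thetaX G σ σX x) = τ * φX x) := by
  classical
  have hfr := G.φ_faithful_right
  have hS := G.antipode_bijective
  obtain ⟨δ, hδ⟩ := exists_delta G.φ G.φ_ne G.φ_integral hfr hS
  obtain ⟨c, hc⟩ : ∃ c, G.φ c ≠ 0 := by
    by_contra! hcon
    exact G.φ_ne (LinearMap.ext hcon)
  have hcs := comul_sigma G.φ G.φ_integral hfr σ hσ
  have hφσ : ∀ a, G.φ (σ a) = G.φ a := by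
    intro a
    have := hσ a 1
    simpa using this.symm
  -- the modular element is an eigenvector of σ
  have hσδ : δ = τ • σ δ := by
    have h : ∀ T : A ⊗[k] A, applyFst k G.φ (TensorProduct.map
        (HopfAlgebra.antipode k ∘ₗ HopfAlgebra.antipode k) σ.toLinearMap T) =
        τ • σ (applyFst k G.φ T) := by
      intro T
      induction T with
      | zero => simp
      | add x y hx hy => simp only [map_add, smul_add, hx, hy]
      | tmul u v => simp [applyFst_tmul, hτ, smul_smul]
    have h1 := hδ (σ c)
    rw [hcs, h, hδ, hφσ, map_smul, smul_comm] at h1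
    exact (smul_right_injective _ hc h1).symm
  let f : A →ₐ[k] k := (Bialgebra.counitAlgHom k A).comp (σ.symm : A →ₐ[k] A)
  have hfl : (Coalgebra.counit (R := k) (A := A)) ∘ₗ σ.symm.toLinearMap = f.toLinearMap := by
    ext a; simp [f]
  have hεδ : Coalgebra.counit (R := k) δ = 1 := by
    have h1 := congrArg (Coalgebra.counit (R := k)) (hδ c)
    rw [← slice_swap] at h1
    have h2 : applySnd k (Coalgebra.counit (R := k) (A := A)) (Coalgebra.comul c) = c := by
      simp [applySnd]
    rw [h2, map_smul, smul_eq_mul] at h1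
    exact (mul_left_cancel₀ hc (by rw [mul_one]; exact h1)).symm
  have hfδ : f δ = τ := by
    rw [hσδ]
    simp [f, hεδ]
  have hX1 := phiX_slice G φX hφX δ hδ
  have hXf := phiX_faithful G φX hφX
  let ρ : X →ₗ[k] X := applySnd k f.toLinearMap ∘ₗ G.α.toLinearMap
  have hρ : ∀ x, ρ x = applySnd k f.toLinearMap (G.α x) := fun x => rfl
  have hθ : ∀ x, thetaX G σ σX x = σX (ρ x) := by
    intro x
    simp [thetaX, hfl, hρ]
  have hφρ : ∀ x, φX (ρ x) = τ * φX x := by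
    intro x
    rw [hρ, slice_swap, hX1, map_smul, smul_eq_mul, mul_comm]
    simp [hfδ]
  have hρmul : ∀ x y, ρ (x * y) = ρ x * ρ y := by
    intro x y
    rw [hρ, map_mul]
    exact applySnd_mul_of_mul _ (by simp) _ _
  have hρs : ∀ x, ∃ y, ρ y = x := fun x => ⟨_, rho_surj G f x⟩
  have hαδ : G.α (δX : X) = (δX : X) ⊗ₜ[k] δ := by
    rw [← sub_eq_zero]
    apply sep_fst (fun x : X => φX ∘ₗ LinearMap.mulLeft k x) (fun n hn => hXf n hn)
    intro x
    have e : φX ∘ₗ LinearMap.mulRight k (δX : X) = ψX := by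
      ext y; simp [hδX]
    have := alpha_span G φX (G.α (δX : X) - (δX : X) ⊗ₜ[k] δ) (by
      intro y
      rw [mul_sub, map_sub, ← map_mul, hX1, applyFst_mul_tmul, e, hψX, hδX]
      simp) x
    rwa [applyFst_tmul_mul, one_mul] at this
  have hφσX : ∀ x, φX (σX x) = φX x := by
    intro x
    have := hσX x 1
    simpa using this
  have hsep : ∀ u v : X, (∀ y, φX (y * u) = φX (y * v)) → u = v := by
    intro u v h
    rw [← sub_eq_zero]
    apply hXf
    intro y
    rw [mul_sub, map_sub, h, sub_self]
  refine ⟨?_, ?_, ?_⟩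
  · intro x
    rw [hθ, hθ]
    congr 1
    apply hsep
    intro y
    obtain ⟨y, rfl⟩ := hρs y
    rw [hσX, ← hρmul, ← hρmul, hφρ, hφρ, hσX]
  · rw [hθ]
    have e1 : ρ (δX : X) = τ • (δX : X) := by
      rw [hρ, hαδ, applySnd_tmul]
      simp [hfδ]
    apply hsep
    intro x
    rw [hσX, e1, smul_mul_assoc, map_smul, smul_eq_mul]
    have e2 : G.φ ∘ₗ LinearMap.mulRight k δ = τ • (G.φ ∘ₗ LinearMap.mulLeft k δ) := by
      ext a
      simp only [LinearMap.comp_apply, LinearMap.mulRight_apply, LinearMap.smul_apply,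
        LinearMap.mulLeft_apply]
      rw [hσ δ a, ← map_smul, ← mul_smul_comm, ← hσδ]
    have a1 := hφX (x * δX)
    have a2 := hφX (δX * x)
    rw [map_mul, hαδ, applySnd_mul_tmul, e2] at a1
    rw [map_mul, hαδ, applySnd_tmul_mul] at a2
    have e3 : ∀ T : X ⊗[k] A, applySnd k (τ • (G.φ ∘ₗ LinearMap.mulLeft k δ)) T =
        τ • applySnd k (G.φ ∘ₗ LinearMap.mulLeft k δ) T := by
      intro T
      induction T with
      | zero => simp
      | add x y hx hy => simp only [map_add, smul_add, hx, hy]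
      | tmul u v => simp [applySnd_tmul, smul_smul]
    rw [e3] at a1
    set w := applySnd k (G.φ ∘ₗ LinearMap.mulLeft k δ) (G.α x) with hw
    have a3 : w * δX = φX (δX * x) • (1 : X) := by
      have : w = (↑δX⁻¹ : X) * (φX (δX * x) • (1 : X)) := by
        rw [← a2, Units.inv_mul_cancel_left]
      rw [this]
      simp
    rw [smul_mul_assoc, a3, smul_smul] at a1
    exact smul_left_injective k (one_ne_zero : (1 : X) ≠ 0) a1
  · intro x
    rw [hθ, hφσX, hφρ]
end
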